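/- arXiv:math/0006013 — 2 statements merged into one kernel-verified Lean document; each statement's English description precedes it below -/
import Mathlib

section
/- Let L : ℝⁿ × ℝⁿ → [0,∞) be lower semicontinuous, convex in the second variable, satisfy the coercivity condition L(x,u) ≥ Θ(u) for a convex superlinear Θ, and let φ : ℝⁿ → [0,∞] be lower semicontinuous, not identically +∞. Define the value function V(t,x) = inf{ ∫₀ᵗ L(y(s),y'(s)) ds + φ(y(t)) : y ∈ W^{1,1}(0,t;ℝⁿ), y(0)=x }. Then V is lower semicontinuous on [0,∞) × ℝⁿ and for every (t,x) the infimum is attained (possibly +∞). -/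
open MeasureTheory Set Filter
open scoped ENNReal

def Superlinear {n : ℕ} (Θ : EuclideanSpace ℝ (Fin n) → ℝ) : Prop :=
  ∀ M : ℝ, ∃ R : ℝ, ∀ u : EuclideanSpace ℝ (Fin n), R ≤ ‖u‖ → M * ‖u‖ ≤ Θ u

/-- The value function of the Bolza problem: infimum of total cost over
absolutely continuous arcs starting at `x` (represented by their integrable
derivative `y'`). -/
noncomputable def bolzaValue {n : ℕ}
    (L : EuclideanSpace ℝ (Fin n) → EuclideanSpace ℝ (Fin n) → ℝ)
    (φ : EuclideanSpace ℝ (Fin n) → ℝ≥0∞)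
    (t : ℝ) (x : EuclideanSpace ℝ (Fin n)) : ℝ≥0∞ :=
  ⨅ (y : ℝ → EuclideanSpace ℝ (Fin n)) (y' : ℝ → EuclideanSpace ℝ (Fin n))
    (_ : IntervalIntegrable y' volume 0 t)
    (_ : ∀ s ∈ Set.Icc (0:ℝ) t, y s = x + ∫ τ in (0:ℝ)..s, y' τ)
    (_ : IntervalIntegrable (fun s => L (y s) (y' s)) volume 0 t),
    ENNReal.ofReal (∫ s in (0:ℝ)..t, L (y s) (y' s)) + φ (y t)

open scoped Topology

/-- Componentwise projection of an absolutely continuous arc is absolutely continuous. -/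
theorem AbsolutelyContinuousOnInterval.euclidean_apply {n : ℕ} {y : ℝ → EuclideanSpace ℝ (Fin n)}
    {a b : ℝ} (hy : AbsolutelyContinuousOnInterval y a b) (k : Fin n) :
    AbsolutelyContinuousOnInterval (fun s => y s k) a b := by
  rw [absolutelyContinuousOnInterval_iff] at hy ⊢
  intro ε hε
  obtain ⟨δ, hδ, h⟩ := hy ε hε
  refine ⟨δ, hδ, fun E hE hlen => lt_of_le_of_lt (Finset.sum_le_sum fun i _ => ?_) (h E hE hlen)⟩
  simpa [dist_eq_norm] using PiLp.norm_apply_le (y (E.2 i).1 - y (E.2 i).2) k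

theorem AbsolutelyContinuousOnInterval.ae_hasDerivAt_euclidean {n : ℕ}
    {y : ℝ → EuclideanSpace ℝ (Fin n)} {a b : ℝ} (hy : AbsolutelyContinuousOnInterval y a b) :
    ∀ᵐ s : ℝ, s ∈ uIcc a b → HasDerivAt y (deriv y s) s := by
  have h : ∀ᵐ s : ℝ, ∀ k : Fin n, s ∈ uIcc a b → DifferentiableAt ℝ (fun s => y s k) s :=
    ae_all_iff.2 fun k => (hy.euclidean_apply k).ae_differentiableAt
  filter_upwards [h] with s hs hmem
  exact (differentiableAt_euclidean.2 fun k => hs k hmem).hasDerivAt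

theorem AbsolutelyContinuousOnInterval.ae_deriv_euclidean_apply {n : ℕ}
    {y : ℝ → EuclideanSpace ℝ (Fin n)} {a b : ℝ} (hy : AbsolutelyContinuousOnInterval y a b)
    (k : Fin n) :
    ∀ᵐ s : ℝ, s ∈ uIcc a b → deriv (fun s => y s k) s = deriv y s k := by
  filter_upwards [hy.ae_hasDerivAt_euclidean] with s hs hmem
  exact (((EuclideanSpace.proj (𝕜 := ℝ) k).hasFDerivAt (x := y s)).comp_hasDerivAt s
    (hs hmem)).deriv

theorem AbsolutelyContinuousOnInterval.intervalIntegrable_deriv_euclidean {n : ℕ}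
    {y : ℝ → EuclideanSpace ℝ (Fin n)} {a b : ℝ} (hy : AbsolutelyContinuousOnInterval y a b) :
    IntervalIntegrable (deriv y) volume a b := by
  rw [intervalIntegrable_iff]
  refine Integrable.of_eval_piLp fun k => ?_
  refine ((intervalIntegrable_iff.1 (hy.euclidean_apply k).intervalIntegrable_deriv).congr ?_)
  rw [Filter.EventuallyEq, ae_restrict_iff' measurableSet_uIoc]
  filter_upwards [hy.ae_deriv_euclidean_apply k] with s hs hmem
  exact hs (uIoc_subset_uIcc hmem)

/-- The fundamental theorem of calculus for absolutely continuous arcs in Euclidean space. -/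
theorem AbsolutelyContinuousOnInterval.integral_deriv_eq_sub_euclidean {n : ℕ}
    {y : ℝ → EuclideanSpace ℝ (Fin n)} {a b : ℝ} (hy : AbsolutelyContinuousOnInterval y a b) :
    ∫ s in a..b, deriv y s = y b - y a := by
  ext k
  have h : ∫ s in a..b, deriv y s k = (∫ s in a..b, deriv y s) k :=
    (EuclideanSpace.proj (𝕜 := ℝ) k).intervalIntegral_comp_comm
      hy.intervalIntegrable_deriv_euclidean
  rw [← h, PiLp.sub_apply, ← (hy.euclidean_apply k).integral_deriv_eq_sub]
  refine intervalIntegral.integral_congr_ae ?_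
  filter_upwards [hy.ae_deriv_euclidean_apply k] with s hs hmem
  exact (hs (uIoc_subset_uIcc hmem)).symm

/-- A superlinear integrand that is jointly lower semicontinuous and convex in the velocity admits
affine minorants in the velocity that are almost exact at a given point and remain valid for all
nearby positions. -/
theorem exists_affine_le_nhds {n : ℕ}
    {L : EuclideanSpace ℝ (Fin n) → EuclideanSpace ℝ (Fin n) → ℝ}
    (hLlsc : LowerSemicontinuous
      (fun p : EuclideanSpace ℝ (Fin n) × EuclideanSpace ℝ (Fin n) => L p.1 p.2))
    (hLconv : ∀ x, ConvexOn ℝ Set.univ (L x))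
    {Θ : EuclideanSpace ℝ (Fin n) → ℝ} (hΘsuper : Superlinear Θ)
    (hcoerc : ∀ x u, Θ u ≤ L x u) {x v : EuclideanSpace ℝ (Fin n)} {a : ℝ} (ha : a < L x v) :
    ∃ (l : EuclideanSpace ℝ (Fin n) →L[ℝ] ℝ) (c : ℝ), l v + c = a ∧
      ∀ᶠ x' in 𝓝 x, ∀ u, l u + c ≤ L x' u := by
  have hcont : Continuous (L x) := continuousOn_univ.1 ((hLconv x).continuousOn isOpen_univ)
  obtain ⟨b, hab, hb⟩ := exists_between ha
  obtain ⟨l, c, hle, heq⟩ := ConvexOn.exists_affine_le_of_lt (𝕜 := ℝ) (mem_univ v) hb isClosed_univ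
    (hcont.lowerSemicontinuous.lowerSemicontinuousOn _) (hLconv x)
  have hle' (u) : l u + c ≤ L x u := by simpa using hle ⟨u, mem_univ u⟩
  simp only [RCLike.re_to_real] at heq
  refine ⟨l, c - (b - a), by linarith, ?_⟩
  obtain ⟨R, hR⟩ := hΘsuper (‖l‖ + |c|)
  set R' := max R 1
  have hlsc : LowerSemicontinuous
      (fun p : EuclideanSpace ℝ (Fin n) × EuclideanSpace ℝ (Fin n) =>
        L p.1 p.2 + -(l p.2)) :=
    hLlsc.add (by fun_prop : Continuous fun p : EuclideanSpace ℝ (Fin n) ×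
      EuclideanSpace ℝ (Fin n) => -(l p.2)).lowerSemicontinuous
  obtain ⟨U, W, hU, -, hxU, hW, hUW⟩ := generalized_tube_lemma (isCompact_singleton (x := x))
    (isCompact_closedBall (0 : EuclideanSpace ℝ (Fin n)) R')
    (hlsc.isOpen_preimage (c - (b - a))) (by
      rintro ⟨p, u⟩ ⟨rfl, -⟩
      have := hle' u
      simp only [mem_preimage, mem_Ioi]
      linarith)
  filter_upwards [hU.mem_nhds (hxU rfl)] with x' hx' u
  rcases le_or_gt ‖u‖ R' with hu | hu
  · have : (x', u) ∈ U ×ˢ W := ⟨hx', hW (by simpa using hu)⟩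
    have := hUW this
    simp only [mem_preimage, mem_Ioi] at this
    linarith
  · have h1 := hR u ((le_max_left _ _).trans hu.le)
    have h2 : 1 ≤ ‖u‖ := (le_max_right R 1).trans hu.le
    have h3 := (le_abs_self _).trans (l.le_opNorm u)
    have h4 := hcoerc x' u
    have h5 := le_abs_self c
    nlinarith [abs_nonneg c]

/-- A family of velocities `v i` controlled by nonnegative running costs `ℓ i` of uniformly bounded
total mass, the control being superlinear: `v` is `o(ℓ)` for large velocities, uniformly in `i`. -/
structure CoerciveFamily {n : ℕ} {ι : Type*} (v : ι → ℝ → EuclideanSpace ℝ (Fin n))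
    (ℓ : ι → ℝ → ℝ) (C : ℝ) : Prop where
  nonneg : ∀ i s, 0 ≤ ℓ i s
  integrable_velocity : ∀ i, Integrable (v i)
  integrable_cost : ∀ i, Integrable (ℓ i)
  integral_cost_le : ∀ i, ∫ s, ℓ i s ≤ C
  growth : ∀ ε > 0, ∃ R : ℝ, 0 ≤ R ∧ ∀ i s, ‖v i s‖ ≤ R + ε * ℓ i s

theorem Ultrafilter.exists_tendsto_of_norm_le {ι X : Type*} [SeminormedAddCommGroup X]
    [ProperSpace X] (U : Ultrafilter ι) {f : ι → X} {r : ℝ} (hf : ∀ i, ‖f i‖ ≤ r) :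
    ∃ z, Tendsto f U (𝓝 z) := by
  obtain ⟨z, -, hz⟩ := (isCompact_closedBall (0 : X) r).ultrafilter_le_nhds (U.map f)
    (le_principal_iff.2 (Eventually.of_forall (f := (U : Filter ι)) fun i => by simpa using hf i))
  exact ⟨z, hz⟩

namespace CoerciveFamily

variable {n : ℕ} {ι : Type*} {v : ι → ℝ → EuclideanSpace ℝ (Fin n)} {ℓ : ι → ℝ → ℝ} {C : ℝ}

theorem dist_integral_le (h : CoerciveFamily v ℓ C) {i : ι} {ε R : ℝ}
    (hR : ∀ s, ‖v i s‖ ≤ R + ε * ℓ i s) (a b : ℝ) :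
    dist (∫ τ in (0 : ℝ)..a, v i τ) (∫ τ in (0 : ℝ)..b, v i τ) ≤
      R * dist a b + ε * ∫ τ in uIoc a b, ℓ i τ := by
  have hv := h.integrable_velocity i
  have hℓ := h.integrable_cost i
  have : IsFiniteMeasure (volume.restrict (uIoc a b)) := ⟨by simp [Real.volume_uIoc]⟩
  rw [dist_comm, dist_eq_norm, intervalIntegral.integral_interval_sub_left hv.intervalIntegrable
    hv.intervalIntegrable]
  calc ‖∫ τ in a..b, v i τ‖ ≤ ∫ τ in uIoc a b, ‖v i τ‖ :=
        intervalIntegral.norm_integral_le_integral_norm_uIoc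
    _ ≤ ∫ τ in uIoc a b, (R + ε * ℓ i τ) :=
        integral_mono hv.norm.integrableOn
          ((integrable_const R).add (hℓ.integrableOn.const_mul ε)) hR
    _ = R * dist a b + ε * ∫ τ in uIoc a b, ℓ i τ := by
        rw [integral_add (integrable_const R) (hℓ.integrableOn.const_mul ε),
          integral_const_mul, setIntegral_const, measureReal_def, Real.volume_uIoc,
          ENNReal.toReal_ofReal (abs_nonneg _), smul_eq_mul, mul_comm, dist_comm, Real.dist_eq]

theorem sum_integral_cost_le (h : CoerciveFamily v ℓ C) (i : ι) {t : Finset ℕ} {I : ℕ → ℝ × ℝ}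
    (hI : Set.PairwiseDisjoint t (fun j => uIoc (I j).1 (I j).2)) :
    ∑ j ∈ t, ∫ τ in uIoc (I j).1 (I j).2, ℓ i τ ≤ C := by
  rw [← integral_biUnion_finset t (fun _ _ => measurableSet_uIoc) hI
    (fun _ _ => (h.integrable_cost i).integrableOn)]
  exact (setIntegral_le_integral (h.integrable_cost i)
    (Eventually.of_forall (h.nonneg i))).trans (h.integral_cost_le i)

/-- The primitives of a coercive family are uniformly absolutely continuous. -/
theorem exists_sum_dist_integral_le (h : CoerciveFamily v ℓ C) {ε : ℝ} (hε : 0 < ε) :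
    ∃ δ > 0, ∀ (t : Finset ℕ) (I : ℕ → ℝ × ℝ),
      Set.PairwiseDisjoint t (fun j => uIoc (I j).1 (I j).2) →
      ∑ j ∈ t, dist (I j).1 (I j).2 < δ → ∀ i,
      ∑ j ∈ t, dist (∫ τ in (0 : ℝ)..(I j).1, v i τ) (∫ τ in (0 : ℝ)..(I j).2, v i τ) ≤ ε := by
  have hC : 0 < |C| + 1 := by positivity
  obtain ⟨R, hR0, hR⟩ := h.growth (ε / 2 / (|C| + 1)) (by positivity)
  refine ⟨ε / 2 / (R + 1), by positivity, fun t I hI hlen i => ?_⟩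
  calc ∑ j ∈ t, dist (∫ τ in (0 : ℝ)..(I j).1, v i τ) (∫ τ in (0 : ℝ)..(I j).2, v i τ)
      ≤ ∑ j ∈ t, (R * dist (I j).1 (I j).2 +
          ε / 2 / (|C| + 1) * ∫ τ in uIoc (I j).1 (I j).2, ℓ i τ) :=
        Finset.sum_le_sum fun j _ => h.dist_integral_le (hR i) _ _
    _ = R * ∑ j ∈ t, dist (I j).1 (I j).2 +
          ε / 2 / (|C| + 1) * ∑ j ∈ t, ∫ τ in uIoc (I j).1 (I j).2, ℓ i τ := by
        rw [Finset.sum_add_distrib, Finset.mul_sum, Finset.mul_sum]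
    _ ≤ (R + 1) * (ε / 2 / (R + 1)) + ε / 2 / (|C| + 1) * (|C| + 1) := by
        have := h.sum_integral_cost_le i hI
        have := le_abs_self C
        gcongr <;> linarith
    _ = ε := by field_simp; ring

/-- The primitives of a coercive family are uniformly equicontinuous. -/
theorem exists_dist_integral_le (h : CoerciveFamily v ℓ C) {ε : ℝ} (hε : 0 < ε) :
    ∃ δ > 0, ∀ a b : ℝ, dist a b < δ → ∀ i,
      dist (∫ τ in (0 : ℝ)..a, v i τ) (∫ τ in (0 : ℝ)..b, v i τ) ≤ ε := by
  obtain ⟨δ, hδ, H⟩ := h.exists_sum_dist_integral_le hε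
  refine ⟨δ, hδ, fun a b hab i => ?_⟩
  simpa using H {0} (fun _ => (a, b)) (by simp) (by simpa using hab) i

theorem integral_cost_mem_Icc (h : CoerciveFamily v ℓ C) {a b : ℝ} (hab : a ≤ b) (i : ι) :
    ∫ τ in a..b, ℓ i τ ∈ Icc 0 C := by
  refine ⟨intervalIntegral.integral_nonneg hab fun τ _ => h.nonneg i τ, ?_⟩
  rw [intervalIntegral.integral_of_le hab]
  exact (setIntegral_le_integral (h.integrable_cost i)
    (Eventually.of_forall (h.nonneg i))).trans (h.integral_cost_le i)

/-- Along an ultrafilter, the primitives of a coercive family converge pointwise to an absolutely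
continuous arc, and the accumulated costs converge to a monotone function. -/
theorem exists_tendsto (h : CoerciveFamily v ℓ C) (U : Ultrafilter ι) :
    ∃ (z : ℝ → EuclideanSpace ℝ (Fin n)) (F : ℝ → ℝ),
      (∀ s, Tendsto (fun i => ∫ τ in (0 : ℝ)..s, v i τ) U (𝓝 (z s))) ∧
      (∀ s, Tendsto (fun i => ∫ τ in (0 : ℝ)..s, ℓ i τ) U (𝓝 (F s))) ∧
      Monotone F ∧ ∀ a b, AbsolutelyContinuousOnInterval z a b := by
  have hv (s : ℝ) : ∃ z, Tendsto (fun i => ∫ τ in (0 : ℝ)..s, v i τ) U (𝓝 z) := by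
    obtain ⟨R, -, hR⟩ := h.growth 1 one_pos
    refine U.exists_tendsto_of_norm_le (r := R * dist s 0 + C) fun i => ?_
    have h1 := h.dist_integral_le (hR i) s 0
    have h2 := h.sum_integral_cost_le i (t := {0}) (I := fun _ => (s, 0)) (by simp)
    simp only [Finset.sum_singleton] at h2
    rw [intervalIntegral.integral_same, dist_zero_right] at h1
    linarith
  have hℓ (s : ℝ) : ∃ z, Tendsto (fun i => ∫ τ in (0 : ℝ)..s, ℓ i τ) U (𝓝 z) := by
    refine U.exists_tendsto_of_norm_le (r := C) fun i => ?_
    rw [Real.norm_eq_abs]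
    rcases le_total 0 s with hs | hs
    · have := h.integral_cost_mem_Icc hs i
      rw [abs_of_nonneg this.1]
      exact this.2
    · have := h.integral_cost_mem_Icc hs i
      rw [intervalIntegral.integral_symm, abs_neg, abs_of_nonneg this.1]
      exact this.2
  choose z hz using hv
  choose F hF using hℓ
  refine ⟨z, F, hz, hF, fun a b hab => ?_, fun a b => ?_⟩
  · refine le_of_tendsto_of_tendsto' (hF a) (hF b) fun i => ?_
    have h1 := intervalIntegral.integral_interval_sub_left (μ := volume)
      (h.integrable_cost i).intervalIntegrable (a := 0) (b := b) (c := a)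
      (h.integrable_cost i).intervalIntegrable
    have h2 := (h.integral_cost_mem_Icc hab i).1
    linarith
  · rw [absolutelyContinuousOnInterval_iff]
    intro ε hε
    obtain ⟨δ, hδ, H⟩ := h.exists_sum_dist_integral_le (half_pos hε)
    refine ⟨δ, hδ, fun E hE hlen => lt_of_le_of_lt ?_ (half_lt_self hε)⟩
    exact le_of_tendsto' (tendsto_finsetSum _ fun j _ => (hz _).dist (hz _))
      (H _ _ hE.2 hlen)

end CoerciveFamily

/-- Pointwise lower semicontinuity: the derivative of the limiting accumulated cost dominates the
Lagrangian evaluated along the limiting arc. -/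
theorem CoerciveFamily.le_of_hasDerivAt {n : ℕ}
    {L : EuclideanSpace ℝ (Fin n) → EuclideanSpace ℝ (Fin n) → ℝ}
    (hLlsc : LowerSemicontinuous
      (fun p : EuclideanSpace ℝ (Fin n) × EuclideanSpace ℝ (Fin n) => L p.1 p.2))
    (hLconv : ∀ x, ConvexOn ℝ Set.univ (L x))
    {Θ : EuclideanSpace ℝ (Fin n) → ℝ} (hΘsuper : Superlinear Θ) (hcoerc : ∀ x u, Θ u ≤ L x u)
    {ι : Type*} {v : ι → ℝ → EuclideanSpace ℝ (Fin n)} {ℓ : ι → ℝ → ℝ} {C : ℝ}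
    (h : CoerciveFamily v ℓ C) (U : Ultrafilter ι)
    {x : ι → EuclideanSpace ℝ (Fin n)} {x₀ : EuclideanSpace ℝ (Fin n)} {t : ι → ℝ} {t₀ : ℝ}
    (hx : Tendsto x U (𝓝 x₀)) (ht : Tendsto t U (𝓝 t₀))
    (hℓ : ∀ i, ∀ τ ∈ Ioc 0 (t i), ℓ i τ = L (x i + ∫ σ in (0 : ℝ)..τ, v i σ) (v i τ))
    {z : ℝ → EuclideanSpace ℝ (Fin n)} {F : ℝ → ℝ}
    (hz : ∀ s, Tendsto (fun i => ∫ τ in (0 : ℝ)..s, v i τ) U (𝓝 (z s)))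
    (hF : ∀ s, Tendsto (fun i => ∫ τ in (0 : ℝ)..s, ℓ i τ) U (𝓝 (F s)))
    {s : ℝ} (hs : s ∈ Ioo 0 t₀) {w : EuclideanSpace ℝ (Fin n)} {f : ℝ}
    (hzs : HasDerivAt z w s) (hFs : HasDerivAt F f s) :
    L (x₀ + z s) w ≤ f := by
  refine le_of_forall_lt fun a ha => ?_
  obtain ⟨a, haa, ha⟩ := exists_between ha
  refine haa.trans_le ?_
  obtain ⟨l, c, rfl, hnear⟩ := exists_affine_le_nhds hLlsc hLconv hΘsuper hcoerc ha
  obtain ⟨r, hr, hball⟩ := Metric.eventually_nhds_iff.1 hnear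
  obtain ⟨δ, hδ, hequi⟩ := h.exists_dist_integral_le (half_pos hr)
  have hstart : ∀ᶠ i in U, dist (x i + ∫ τ in (0 : ℝ)..s, v i τ) (x₀ + z s) < r / 2 :=
    Metric.tendsto_nhds.1 (hx.add (hz s)) _ (half_pos hr)
  have hincr : ∀ᶠ k in 𝓝[>] (0 : ℝ),
      l (z (s + k) - z s) + c * k ≤ F (s + k) - F s := by
    have hsmall : ∀ᶠ k in 𝓝[>] (0 : ℝ), k < min δ (t₀ - s) :=
      eventually_nhdsWithin_of_eventually_nhds
        (eventually_lt_nhds (lt_min hδ (sub_pos.2 hs.2)))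
    filter_upwards [hsmall, self_mem_nhdsWithin] with k hk hk0
    rw [mem_Ioi] at hk0
    rw [lt_min_iff] at hk
    have htime : ∀ᶠ i in U, s + k < t i := ht.eventually_const_lt (by linarith)
    refine le_of_tendsto_of_tendsto
      (((l.continuous.tendsto _).comp ((hz (s + k)).sub (hz s))).add_const (c * k))
      ((hF (s + k)).sub (hF s)) ?_
    filter_upwards [hstart, htime] with i hi hti
    have hv := h.integrable_velocity i
    simp only [Function.comp_apply]
    rw [intervalIntegral.integral_interval_sub_left hv.intervalIntegrable hv.intervalIntegrable,
      intervalIntegral.integral_interval_sub_left (h.integrable_cost i).intervalIntegrable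
        (h.integrable_cost i).intervalIntegrable,
      ← l.intervalIntegral_comp_comm hv.intervalIntegrable]
    have hconst : c * k = ∫ _ in s..(s + k), c := by simp [mul_comm]
    have hlv : IntervalIntegrable (fun τ => l (v i τ)) volume s (s + k) :=
      (l.integrable_comp hv).intervalIntegrable
    rw [hconst, ← intervalIntegral.integral_add hlv intervalIntegrable_const]
    refine intervalIntegral.integral_mono_on (by linarith)
      (hlv.add intervalIntegrable_const) (h.integrable_cost i).intervalIntegrable fun τ hτ => ?_
    rw [hℓ i τ ⟨hs.1.trans_le hτ.1, hτ.2.trans hti.le⟩]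
    refine hball ?_ _
    have h1 : dist (∫ σ in (0 : ℝ)..τ, v i σ) (∫ σ in (0 : ℝ)..s, v i σ) ≤ r / 2 :=
      hequi τ s (by rw [Real.dist_eq, abs_of_nonneg] <;> linarith [hτ.1, hτ.2]) i
    calc dist (x i + ∫ σ in (0 : ℝ)..τ, v i σ) (x₀ + z s)
        ≤ dist (x i + ∫ σ in (0 : ℝ)..τ, v i σ) (x i + ∫ σ in (0 : ℝ)..s, v i σ) +
          dist (x i + ∫ σ in (0 : ℝ)..s, v i σ) (x₀ + z s) := dist_triangle _ _ _
      _ < r := by rw [dist_add_left]; linarith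
  refine le_of_tendsto_of_tendsto
    (((l.continuous.tendsto _).comp hzs.tendsto_slope_zero_right).add_const c)
    hFs.tendsto_slope_zero_right ?_
  filter_upwards [hincr, self_mem_nhdsWithin] with k hk hk0
  rw [mem_Ioi] at hk0
  simp only [Function.comp_apply, map_smul, smul_eq_mul]
  calc k⁻¹ * l (z (s + k) - z s) + c = k⁻¹ * (l (z (s + k) - z s) + c * k) := by field_simp
    _ ≤ k⁻¹ * (F (s + k) - F s) := by gcongr

/-- `y` is an arc on `[0, t]` issued from `x`, with integrable derivative `y'` and integrable
running cost. -/
structure IsBolzaArc {n : ℕ} (L : EuclideanSpace ℝ (Fin n) → EuclideanSpace ℝ (Fin n) → ℝ)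
    (t : ℝ) (x : EuclideanSpace ℝ (Fin n)) (y y' : ℝ → EuclideanSpace ℝ (Fin n)) : Prop where
  intervalIntegrable_deriv : IntervalIntegrable y' volume 0 t
  eq_integral : ∀ s ∈ Set.Icc (0:ℝ) t, y s = x + ∫ τ in (0:ℝ)..s, y' τ
  intervalIntegrable_cost : IntervalIntegrable (fun s => L (y s) (y' s)) volume 0 t

/-- Closure theorem: arcs with convergent horizons, initial points and cost bounds have a limiting
arc whose cost is at most the limiting bound. -/
theorem exists_isBolzaArc_of_tendsto {n : ℕ}
    {L : EuclideanSpace ℝ (Fin n) → EuclideanSpace ℝ (Fin n) → ℝ}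
    (hL0 : ∀ x u, 0 ≤ L x u)
    (hLlsc : LowerSemicontinuous
      (fun p : EuclideanSpace ℝ (Fin n) × EuclideanSpace ℝ (Fin n) => L p.1 p.2))
    (hLconv : ∀ x, ConvexOn ℝ Set.univ (L x))
    {Θ : EuclideanSpace ℝ (Fin n) → ℝ} (hΘsuper : Superlinear Θ) (hcoerc : ∀ x u, Θ u ≤ L x u)
    {φ : EuclideanSpace ℝ (Fin n) → ℝ≥0∞} (hφlsc : LowerSemicontinuous φ)
    {ι : Type*} (U : Ultrafilter ι)
    {x : ι → EuclideanSpace ℝ (Fin n)} {x₀ : EuclideanSpace ℝ (Fin n)} {t : ι → ℝ} {t₀ : ℝ}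
    (ht0 : ∀ i, 0 ≤ t i) (hx : Tendsto x U (𝓝 x₀)) (ht : Tendsto t U (𝓝 t₀))
    {c : ι → ℝ≥0∞} {c₀ : ℝ≥0∞} {C : ℝ} (hC0 : 0 ≤ C) (hcC : ∀ i, c i ≤ ENNReal.ofReal C)
    (hc : Tendsto c U (𝓝 c₀))
    (harc : ∀ i, ∃ y y', IsBolzaArc L (t i) (x i) y y' ∧
      ENNReal.ofReal (∫ s in (0:ℝ)..(t i), L (y s) (y' s)) + φ (y (t i)) ≤ c i) :
    ∃ y y', IsBolzaArc L t₀ x₀ y y' ∧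
      ENNReal.ofReal (∫ s in (0:ℝ)..t₀, L (y s) (y' s)) + φ (y t₀) ≤ c₀ := by
  choose y y' hyarc hycost using harc
  set v : ι → ℝ → EuclideanSpace ℝ (Fin n) := fun i => (Ioc 0 (t i)).indicator (y' i)
  set ℓ : ι → ℝ → ℝ := fun i => (Ioc 0 (t i)).indicator fun s => L (y i s) (y' i s)
  have ht₀ : 0 ≤ t₀ := ge_of_tendsto' ht ht0
  have hy (i : ι) (s : ℝ) (hs : s ∈ Icc 0 (t i)) :
      y i s = x i + ∫ τ in (0 : ℝ)..s, v i τ := by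
    rw [(hyarc i).eq_integral s hs, intervalIntegral.integral_of_le hs.1,
      intervalIntegral.integral_of_le hs.1, setIntegral_indicator measurableSet_Ioc,
      inter_eq_left.2 (Ioc_subset_Ioc_right hs.2)]
  have hℓint (i : ι) : ∫ s, ℓ i s = ∫ s in (0:ℝ)..(t i), L (y i s) (y' i s) := by
    rw [intervalIntegral.integral_of_le (ht0 i), integral_indicator measurableSet_Ioc]
  have hfam : CoerciveFamily v ℓ C := by
    refine ⟨fun i s => indicator_nonneg (fun _ _ => hL0 _ _) s, fun i => ?_, fun i => ?_,
      fun i => ?_, fun ε hε => ?_⟩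
    · exact ((intervalIntegrable_iff_integrableOn_Ioc_of_le (ht0 i)).1
        (hyarc i).intervalIntegrable_deriv).integrable_indicator measurableSet_Ioc
    · exact ((intervalIntegrable_iff_integrableOn_Ioc_of_le (ht0 i)).1
        (hyarc i).intervalIntegrable_cost).integrable_indicator measurableSet_Ioc
    · rw [hℓint]
      exact (ENNReal.ofReal_le_ofReal_iff hC0).1
        ((le_self_add.trans (hycost i)).trans (hcC i))
    · obtain ⟨R, hR⟩ := hΘsuper ε⁻¹
      refine ⟨max R 0, le_max_right _ _, fun i s => ?_⟩
      by_cases hs : s ∈ Ioc 0 (t i)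
      · simp only [v, ℓ, indicator_of_mem hs]
        have h0 := hL0 (y i s) (y' i s)
        rcases le_total ‖y' i s‖ R with hle | hle
        · have := le_max_left R 0
          nlinarith [mul_nonneg hε.le h0]
        · have h1 := (hR _ hle).trans (hcoerc (y i s) _)
          rw [inv_mul_le_iff₀ hε] at h1
          linarith [le_max_right R 0]
      · simp [v, ℓ, indicator_of_notMem hs]
  obtain ⟨z, F, hz, hF, hFmono, hzac⟩ := hfam.exists_tendsto U
  have hz0 : z 0 = 0 := tendsto_nhds_unique (hz 0) (by simp)
  have hF0 : F 0 = 0 := tendsto_nhds_unique (hF 0) (by simp)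
  have hzcont : Continuous z := continuous_iff_continuousAt.2 fun s =>
    (hzac (s - 1) (s + 1)).continuousOn.continuousAt (by
      rw [uIcc_of_le (by linarith)]
      exact Icc_mem_nhds (by linarith) (by linarith))
  have hle : ∀ᵐ s, s ∈ Ioc 0 t₀ → L (x₀ + z s) (deriv z s) ≤ deriv F s := by
    filter_upwards [(hzac 0 t₀).ae_hasDerivAt_euclidean, hFmono.ae_differentiableAt,
      compl_mem_ae_iff.2 (measure_singleton t₀)] with s hs hFs hne hmem
    refine hfam.le_of_hasDerivAt hLlsc hLconv hΘsuper hcoerc U hx ht (fun i τ hτ => ?_) hz hF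
      ⟨hmem.1, lt_of_le_of_ne hmem.2 hne⟩
      (hs (by rw [uIcc_of_le ht₀]; exact Ioc_subset_Icc_self hmem)) hFs.hasDerivAt
    rw [← hy i τ (Ioc_subset_Icc_self hτ)]
    simp only [v, ℓ, indicator_of_mem hτ]
  have hFint : IntervalIntegrable (deriv F) volume 0 t₀ :=
    (hFmono.monotoneOn _).intervalIntegrable_deriv
  have hLint : IntervalIntegrable (fun s => L (x₀ + z s) (deriv z s)) volume 0 t₀ := by
    rw [intervalIntegrable_iff_integrableOn_Ioc_of_le ht₀] at hFint ⊢
    refine hFint.mono' (hLlsc.measurable.comp ((measurable_const.add hzcont.measurable).prodMk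
      (measurable_deriv z))).aestronglyMeasurable ?_
    rw [ae_restrict_iff' measurableSet_Ioc]
    filter_upwards [hle] with s hs hmem
    rw [Real.norm_of_nonneg (hL0 _ _)]
    exact hs hmem
  refine ⟨fun s => x₀ + z s, deriv z,
    ⟨(hzac 0 t₀).intervalIntegrable_deriv_euclidean, fun s _ => ?_, hLint⟩, ?_⟩
  · rw [(hzac 0 s).integral_deriv_eq_sub_euclidean, hz0, sub_zero]
  have hcost : ∫ s in (0:ℝ)..t₀, L (x₀ + z s) (deriv z s) ≤ F t₀ := by
    calc ∫ s in (0:ℝ)..t₀, L (x₀ + z s) (deriv z s) ≤ ∫ s in (0:ℝ)..t₀, deriv F s := by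
          rw [intervalIntegrable_iff_integrableOn_Ioc_of_le ht₀] at hLint hFint
          rw [intervalIntegral.integral_of_le ht₀, intervalIntegral.integral_of_le ht₀]
          exact setIntegral_mono_on_ae hLint hFint measurableSet_Ioc hle
      _ ≤ F t₀ := by
          have h1 := (hFmono.monotoneOn (uIcc 0 t₀)).intervalIntegral_deriv_mem_uIcc
          rw [hF0, sub_zero, uIcc_of_le (hF0 ▸ hFmono ht₀)] at h1
          exact h1.2
  have hend : Tendsto (fun i => y i (t i)) U (𝓝 (x₀ + z t₀)) := by
    have hdist : Tendsto (fun i => dist (∫ τ in (0 : ℝ)..t₀, v i τ) (∫ τ in (0 : ℝ)..(t i), v i τ))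
        U (𝓝 0) := by
      refine Metric.tendsto_nhds.2 fun ε hε => ?_
      obtain ⟨δ, hδ, hequi⟩ := hfam.exists_dist_integral_le (half_pos hε)
      filter_upwards [Metric.tendsto_nhds.1 ht δ hδ] with i hi
      rw [dist_zero_right, Real.norm_of_nonneg dist_nonneg]
      exact (hequi _ _ (by rwa [dist_comm]) i).trans_lt (half_lt_self hε)
    exact (hx.add ((tendsto_iff_of_dist hdist).1 (hz t₀))).congr fun i =>
      (hy i _ (right_mem_Icc.2 (ht0 i))).symm
  have hFi (i : ι) : ENNReal.ofReal (∫ τ in (0 : ℝ)..t₀, ℓ i τ) + φ (y i (t i)) ≤ c i := by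
    refine le_trans ?_ (hycost i)
    gcongr
    rw [← hℓint, intervalIntegral.integral_of_le ht₀]
    exact setIntegral_le_integral (hfam.integrable_cost i) (Eventually.of_forall (hfam.nonneg i))
  have hlim := ENNReal.tendsto_ofReal (hF t₀)
  have hFc : ENNReal.ofReal (F t₀) ≤ c₀ :=
    le_of_tendsto_of_tendsto' hlim hc fun i => le_self_add.trans (hFi i)
  refine (add_le_add_left (ENNReal.ofReal_le_ofReal hcost) _).trans
    (add_le_of_le_tsub_left_of_le hFc ?_)
  refine le_of_forall_lt_imp_le_of_dense fun b hb => ?_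
  refine ge_of_tendsto (ENNReal.Tendsto.sub hc hlim (Or.inr ENNReal.ofReal_ne_top)) ?_
  filter_upwards [hend.eventually (hφlsc _ _ hb)] with i hi
  exact hi.le.trans (ENNReal.le_sub_of_add_le_left ENNReal.ofReal_ne_top (hFi i))

theorem IsBolzaArc.bolzaValue_le {n : ℕ}
    {L : EuclideanSpace ℝ (Fin n) → EuclideanSpace ℝ (Fin n) → ℝ} {t : ℝ}
    {x : EuclideanSpace ℝ (Fin n)} {y y' : ℝ → EuclideanSpace ℝ (Fin n)}
    (h : IsBolzaArc L t x y y') (φ : EuclideanSpace ℝ (Fin n) → ℝ≥0∞) :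
    bolzaValue L φ t x ≤ ENNReal.ofReal (∫ s in (0:ℝ)..t, L (y s) (y' s)) + φ (y t) :=
  iInf_le_of_le y <| iInf_le_of_le y' <| iInf_le_of_le h.intervalIntegrable_deriv <|
    iInf_le_of_le h.eq_integral <| iInf_le_of_le h.intervalIntegrable_cost le_rfl

theorem exists_isBolzaArc_of_bolzaValue_lt {n : ℕ}
    {L : EuclideanSpace ℝ (Fin n) → EuclideanSpace ℝ (Fin n) → ℝ}
    {φ : EuclideanSpace ℝ (Fin n) → ℝ≥0∞} {t : ℝ} {x : EuclideanSpace ℝ (Fin n)} {c : ℝ≥0∞}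
    (h : bolzaValue L φ t x < c) :
    ∃ y y', IsBolzaArc L t x y y' ∧
      ENNReal.ofReal (∫ s in (0:ℝ)..t, L (y s) (y' s)) + φ (y t) ≤ c := by
  simp only [bolzaValue, iInf_lt_iff] at h
  obtain ⟨y, y', h1, h2, h3, h4⟩ := h
  exact ⟨y, y', ⟨h1, h2, h3⟩, h4.le⟩

theorem isBolzaArc_const {n : ℕ} (L : EuclideanSpace ℝ (Fin n) → EuclideanSpace ℝ (Fin n) → ℝ)
    (t : ℝ) (x : EuclideanSpace ℝ (Fin n)) : IsBolzaArc L t x (fun _ => x) (fun _ => 0) :=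
  ⟨intervalIntegrable_const, by simp, intervalIntegrable_const⟩

theorem stmt_6 {n : ℕ}
    (L : EuclideanSpace ℝ (Fin n) → EuclideanSpace ℝ (Fin n) → ℝ)
    (hL0 : ∀ x u, 0 ≤ L x u)
    (hLlsc : LowerSemicontinuous
      (fun p : EuclideanSpace ℝ (Fin n) × EuclideanSpace ℝ (Fin n) => L p.1 p.2))
    (hLconv : ∀ x, ConvexOn ℝ Set.univ (L x))
    (Θ : EuclideanSpace ℝ (Fin n) → ℝ) (hΘ0 : ∀ u, 0 ≤ Θ u)
    (hΘconv : ConvexOn ℝ Set.univ Θ) (hΘsuper : Superlinear Θ)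
    (hcoerc : ∀ x u, Θ u ≤ L x u)
    (φ : EuclideanSpace ℝ (Fin n) → ℝ≥0∞)
    (hφlsc : LowerSemicontinuous φ) (hφ : ∃ x, φ x ≠ ⊤) :
    LowerSemicontinuousOn (fun p : ℝ × EuclideanSpace ℝ (Fin n) => bolzaValue L φ p.1 p.2)
        (Set.Ici (0:ℝ) ×ˢ Set.univ) ∧
      ∀ t : ℝ, 0 ≤ t → ∀ x : EuclideanSpace ℝ (Fin n),
        ∃ (y y' : ℝ → EuclideanSpace ℝ (Fin n)),
          IntervalIntegrable y' volume 0 t ∧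
          (∀ s ∈ Set.Icc (0:ℝ) t, y s = x + ∫ τ in (0:ℝ)..s, y' τ) ∧
          IntervalIntegrable (fun s => L (y s) (y' s)) volume 0 t ∧
          bolzaValue L φ t x
            = ENNReal.ofReal (∫ s in (0:ℝ)..t, L (y s) (y' s)) + φ (y t) := by
  refine ⟨?_, fun t ht x => ?_⟩
  · rintro ⟨t, x⟩ - a ha
    obtain ⟨c, hac, hc⟩ := exists_between ha
    by_contra hnot
    have hfreq : ∃ᶠ p in 𝓝[Set.Ici (0:ℝ) ×ˢ Set.univ] (t, x), bolzaValue L φ p.1 p.2 ≤ a :=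
      fun h => hnot (h.mono fun p hp => not_le.1 hp)
    obtain ⟨p, hp, hpa⟩ := exists_seq_forall_of_frequently
      (hfreq.and_eventually self_mem_nhdsWithin)
    have hp' := (hp.mono_right nhdsWithin_le_nhds).mono_left Nat.hyperfilter_le_atTop
    obtain ⟨y, y', h, hle⟩ := exists_isBolzaArc_of_tendsto hL0 hLlsc hLconv hΘsuper hcoerc hφlsc
      (hyperfilter ℕ) (fun k => (hpa k).2.1) hp'.snd_nhds hp'.fst_nhds
      (c := fun _ => c) (C := c.toReal) ENNReal.toReal_nonneg
      (fun _ => (ENNReal.ofReal_toReal hc.ne_top).ge) tendsto_const_nhds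
      (fun k => exists_isBolzaArc_of_bolzaValue_lt ((hpa k).1.trans_lt hac))
    exact absurd ((h.bolzaValue_le φ).trans hle) (not_le.2 hc)
  · rcases eq_or_ne (bolzaValue L φ t x) ⊤ with htop | hfin
    · have h := isBolzaArc_const L t x
      refine ⟨_, _, h.1, h.2, h.3, ?_⟩
      exact le_antisymm (h.bolzaValue_le φ) (htop ▸ le_top)
    · set V := bolzaValue L φ t x with hV
      have hlim : Tendsto (fun k : ℕ => V + ((k : ℝ≥0∞) + 1)⁻¹) atTop (𝓝 V) := by
        have h1 := (tendsto_add_atTop_iff_nat 1).2 ENNReal.tendsto_inv_nat_nhds_zero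
        simpa using h1.const_add V
      obtain ⟨y, y', h, hle⟩ := exists_isBolzaArc_of_tendsto hL0 hLlsc hLconv hΘsuper hcoerc hφlsc
        (hyperfilter ℕ) (fun _ => ht) tendsto_const_nhds tendsto_const_nhds
        (c := fun k : ℕ => V + ((k : ℝ≥0∞) + 1)⁻¹) (C := (V + 1).toReal) ENNReal.toReal_nonneg
        (fun k => by
          rw [ENNReal.ofReal_toReal (by simp [hfin])]
          gcongr
          simp)
        (hlim.mono_left Nat.hyperfilter_le_atTop)
        (fun k => exists_isBolzaArc_of_bolzaValue_lt
          (ENNReal.lt_add_right hfin (by simp)))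
      exact ⟨y, y', h.1, h.2, h.3, le_antisymm (h.bolzaValue_le φ) hle⟩
end

section
/- Assume L : ℝⁿ×ℝⁿ → [0,∞) is lower semicontinuous, convex in u, coercive, and locally bounded, and let y : [0,T] → ℝⁿ be Lipschitz. Then L(y(t), y'(t)) = L⁺(y(t), y'(t)) for almost every t ∈ [0,T]. -/
open MeasureTheory Set Filter
open scoped ENNReal Topology

def LocallyBounded {n : ℕ}
    (L : EuclideanSpace ℝ (Fin n) → EuclideanSpace ℝ (Fin n) → ℝ) : Prop :=
  ∀ x₀ : EuclideanSpace ℝ (Fin n), ∃ M r : ℝ, 0 < r ∧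
    ∀ x u, ‖x - x₀‖ ≤ r → ‖u‖ ≤ r → L x u ≤ M

/-- Infimum of `∫_{-h}^0 L(y,y')` over absolutely continuous arcs `y` on `[-h,0]`
with `y(-h) = x - h•u` and `y(0) = x`. -/
noncomputable def arcInf {n : ℕ}
    (L : EuclideanSpace ℝ (Fin n) → EuclideanSpace ℝ (Fin n) → ℝ)
    (x u : EuclideanSpace ℝ (Fin n)) (h : ℝ) : ℝ≥0∞ :=
  ⨅ (y : ℝ → EuclideanSpace ℝ (Fin n)) (y' : ℝ → EuclideanSpace ℝ (Fin n))
    (_ : IntervalIntegrable y' volume (-h) 0)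
    (_ : ∀ s ∈ Set.Icc (-h) (0:ℝ), y s = (x - h • u) + ∫ τ in (-h)..s, y' τ)
    (_ : y 0 = x)
    (_ : IntervalIntegrable (fun s => L (y s) (y' s)) volume (-h) 0),
    ENNReal.ofReal (∫ s in (-h)..(0:ℝ), L (y s) (y' s))

/-- `L⁺(x,u) = limsup_{h→0+} (1/h) inf{∫_{-h}^0 L(y,y') : y(-h)=x-hu, y(0)=x}`. -/
noncomputable def LPlus {n : ℕ}
    (L : EuclideanSpace ℝ (Fin n) → EuclideanSpace ℝ (Fin n) → ℝ)
    (x u : EuclideanSpace ℝ (Fin n)) : ℝ≥0∞ :=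
  limsup (fun h : ℝ => arcInf L x u h / ENNReal.ofReal h) (𝓝[>] (0:ℝ))

/-- Euclidean space of dimension `n`. -/
abbrev Euc (n : ℕ) := EuclideanSpace ℝ (Fin n)

section LowerBound

variable {n : ℕ} {L : Euc n → Euc n → ℝ} {Θ : Euc n → ℝ}

lemma lowerSemicontinuous_snd
    (hLlsc : LowerSemicontinuous (fun p : Euc n × Euc n => L p.1 p.2)) (x : Euc n) :
    LowerSemicontinuous (L x) :=
  hLlsc.comp (g := fun v => (x, v)) (by fun_prop)

/-- Every value strictly below `L x u` is attained at `u` by an affine function which minorizes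
`L z` for all `z` near `x`. -/
lemma exists_local_affine_minorant
    (hLlsc : LowerSemicontinuous (fun p : Euc n × Euc n => L p.1 p.2))
    (hLconv : ∀ x, ConvexOn ℝ Set.univ (L x)) (hΘsuper : Superlinear Θ)
    (hcoerc : ∀ x u, Θ u ≤ L x u) (x u : Euc n) {a : ℝ} (ha : a < L x u) :
    ∃ (l : Euc n →L[ℝ] ℝ) (c δ : ℝ), 0 < δ ∧ l u + c = a ∧
      ∀ z, ‖z - x‖ < δ → ∀ v, l v + c ≤ L z v := by
  obtain ⟨a', haa', ha'⟩ := exists_between ha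
  obtain ⟨l, c', hle, heq⟩ := (hLconv x).exists_affine_le_of_lt (𝕜 := ℝ) (mem_univ u) ha'
    isClosed_univ (lowerSemicontinuousOn_univ_iff.2 (lowerSemicontinuous_snd hLlsc x))
  replace hle : ∀ v, l v + c' ≤ L x v := fun v => by simpa using hle ⟨v, mem_univ v⟩
  replace heq : l u + c' = a' := by simpa using heq
  set c := c' - (a' - a) with hc
  obtain ⟨R₀, hR₀⟩ := hΘsuper (‖l‖ + 1)
  set R := max R₀ |c|
  have hopen : IsOpen {p : Euc n × Euc n | l p.2 + c < L p.1 p.2} := by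
    have h : LowerSemicontinuous (fun p : Euc n × Euc n => L p.1 p.2 + -(l p.2 + c)) :=
      hLlsc.add (Continuous.lowerSemicontinuous (by fun_prop))
    convert h.isOpen_preimage 0 using 1
    ext p
    simp only [mem_ofPred_eq, mem_preimage, mem_Ioi]
    constructor <;> intro h <;> linarith
  obtain ⟨V, W, hV, -, hxV, hRW, hVW⟩ := generalized_tube_lemma (isCompact_singleton (x := x))
    (isCompact_closedBall (0 : Euc n) R) hopen (by
      rintro ⟨z, v⟩ ⟨hz, -⟩
      obtain rfl : z = x := hz
      have := hle v
      simp only [mem_ofPred_eq]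
      linarith)
  obtain ⟨δ, hδ, hball⟩ := Metric.isOpen_iff.1 hV x (hxV rfl)
  refine ⟨l, c, δ, hδ, by rw [hc]; linarith, fun z hz v => ?_⟩
  by_cases hv : ‖v‖ ≤ R
  · have : (z, v) ∈ V ×ˢ W :=
      ⟨hball (by simpa [dist_eq_norm] using hz), hRW (by simpa using hv)⟩
    exact (hVW this).le
  · push Not at hv
    have h1 := hR₀ v ((le_max_left _ _).trans hv.le)
    have h2 : |c| ≤ ‖v‖ := (le_max_right _ _).trans hv.le
    have h3 : l v ≤ ‖l‖ * ‖v‖ := (le_abs_self _).trans (l.le_opNorm v)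
    have h4 := le_abs_self c
    have h5 := hcoerc z v
    linarith

/-- A competitor for `arcInf L x u h` costs at least `h * a` when `a < L x u` and `h` is small. -/
lemma eventually_mul_le_arcInf
    (hL0 : ∀ x u, 0 ≤ L x u)
    (hLlsc : LowerSemicontinuous (fun p : Euc n × Euc n => L p.1 p.2))
    (hLconv : ∀ x, ConvexOn ℝ Set.univ (L x)) (hΘsuper : Superlinear Θ)
    (hcoerc : ∀ x u, Θ u ≤ L x u) (x u : Euc n) {a : ℝ} (ha : a < L x u) :
    ∀ᶠ h in 𝓝[>] (0 : ℝ), ENNReal.ofReal (h * a) ≤ arcInf L x u h := by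
  obtain ⟨l, c, δ, hδ, hlu, hmin⟩ :=
    exists_local_affine_minorant hLlsc hLconv hΘsuper hcoerc x u ha
  obtain ⟨R, hR⟩ := hΘsuper 1
  have hlin : ∀ z v, ‖v‖ ≤ L z v + |R| := by
    intro z v
    rcases le_total R ‖v‖ with h | h
    · have := hR v h
      have := hcoerc z v
      have := abs_nonneg R
      linarith
    · have := hL0 z v
      have := le_abs_self R
      linarith
  have hsmall : ∀ᶠ h in 𝓝[>] (0 : ℝ), h * (‖u‖ + |a| + |R|) < δ := by
    refine Filter.Tendsto.eventually_lt_const (v := 0) hδ ?_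
    have : Tendsto (fun h : ℝ => h * (‖u‖ + |a| + |R|)) (𝓝 0) (𝓝 (0 * (‖u‖ + |a| + |R|))) :=
      tendsto_id.mul_const _
    rw [zero_mul] at this
    exact this.mono_left nhdsWithin_le_nhds
  filter_upwards [hsmall, self_mem_nhdsWithin] with h hh hpos
  replace hpos : 0 < h := hpos
  have hle : -h ≤ 0 := by linarith
  simp only [arcInf, le_iInf_iff]
  intro z z' hz' hz hz0 hint
  apply ENNReal.ofReal_le_ofReal
  by_contra! hlt
  have hspeed : ∫ s in (-h)..0, ‖z' s‖ ≤ h * (|a| + |R|) := by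
    have h1 : ∫ s in (-h)..0, ‖z' s‖ ≤ ∫ s in (-h)..0, (L (z s) (z' s) + |R|) :=
      intervalIntegral.integral_mono_on hle hz'.norm (hint.add (by simp)) fun s _ => hlin _ _
    rw [intervalIntegral.integral_add hint (by simp), intervalIntegral.integral_const] at h1
    have h2 : h * a ≤ h * |a| := by gcongr; exact le_abs_self a
    simp only [smul_eq_mul] at h1
    linarith
  have hclose : ∀ s ∈ Icc (-h) 0, ‖z s - x‖ < δ := by
    intro s hs
    have h1 : ‖∫ τ in (-h)..s, z' τ‖ ≤ h * (|a| + |R|) := by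
      refine (intervalIntegral.norm_integral_le_integral_norm hs.1).trans (le_trans ?_ hspeed)
      exact intervalIntegral.integral_mono_interval le_rfl hs.1 hs.2
        (Eventually.of_forall fun _ => norm_nonneg _) hz'.norm
    rw [hz s hs]
    calc ‖x - h • u + (∫ τ in (-h)..s, z' τ) - x‖ = ‖(∫ τ in (-h)..s, z' τ) - h • u‖ := by
          congr 1; abel
      _ ≤ ‖∫ τ in (-h)..s, z' τ‖ + ‖h • u‖ := norm_sub_le _ _
      _ ≤ h * (|a| + |R|) + h * ‖u‖ := by
          rw [norm_smul, Real.norm_of_nonneg hpos.le]; gcongr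
      _ < δ := by linarith
  have hmean : ∫ τ in (-h)..0, z' τ = h • u := by
    have := hz 0 ⟨hle, le_rfl⟩
    rw [hz0] at this
    have h2 : x = x - h • u + h • u := by abel
    exact (add_left_cancel (h2.symm.trans this)).symm
  have hl : IntervalIntegrable (fun s => l (z' s)) volume (-h) 0 :=
    ⟨l.integrable_comp hz'.1, l.integrable_comp hz'.2⟩
  have : ∫ s in (-h)..0, (l (z' s) + c) ≤ ∫ s in (-h)..0, L (z s) (z' s) :=
    intervalIntegral.integral_mono_on hle (hl.add (by simp)) hint
      fun s hs => hmin _ (hclose s hs) _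
  rw [intervalIntegral.integral_add hl (by simp), intervalIntegral.integral_const,
    l.intervalIntegral_comp_comm hz', hmean, map_smul] at this
  simp only [smul_eq_mul] at this
  rw [← hlu] at hlt
  linarith

lemma ofReal_le_LPlus
    (hL0 : ∀ x u, 0 ≤ L x u)
    (hLlsc : LowerSemicontinuous (fun p : Euc n × Euc n => L p.1 p.2))
    (hLconv : ∀ x, ConvexOn ℝ Set.univ (L x)) (hΘsuper : Superlinear Θ)
    (hcoerc : ∀ x u, Θ u ≤ L x u) (x u : Euc n) :
    ENNReal.ofReal (L x u) ≤ LPlus L x u := by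
  refine le_of_forall_lt_imp_le_of_dense fun b hb => ?_
  have hbtop : b ≠ ∞ := hb.ne_top
  have hba : b.toReal < L x u := by
    rwa [ENNReal.lt_ofReal_iff_toReal_lt hbtop] at hb
  refine le_trans ?_ (liminf_le_limsup)
  refine le_liminf_of_le (by isBoundedDefault) ?_
  filter_upwards [eventually_mul_le_arcInf hL0 hLlsc hLconv hΘsuper hcoerc x u hba,
    self_mem_nhdsWithin] with h hh hpos
  replace hpos : 0 < h := hpos
  rw [ENNReal.le_div_iff_mul_le (by simp [hpos]) (by simp)]
  refine le_trans (le_of_eq ?_) hh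
  rw [ENNReal.ofReal_mul hpos.le, ENNReal.ofReal_toReal hbtop, mul_comm]

end LowerBound

section TimeChange

/-- A density `ρ` bounded between positive constants has a primitive which is an order isomorphism
of `ℝ`, and integrals transform accordingly. -/
lemma exists_orderIso_integral_comp_symm {ρ : ℝ → ℝ} (hρ : Measurable ρ) {ρ₁ ρ₂ : ℝ}
    (hρ₁ : 0 < ρ₁) (h₁ : ∀ s, ρ₁ ≤ ρ s) (h₂ : ∀ s, ρ s ≤ ρ₂) (σ a : ℝ) :
    ∃ e : ℝ ≃o ℝ, (∀ s, e s = σ + ∫ τ in a..s, ρ τ) ∧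
      ∀ {G : Type} [NormedAddCommGroup G] [NormedSpace ℝ G] (F : ℝ → G) (p q : ℝ), p ≤ q →
        ∫ τ in (e p)..(e q), F (e.symm τ) = ∫ s in p..q, ρ s • F s := by
  have hint : ∀ p q, IntervalIntegrable ρ volume p q := fun p q =>
    (intervalIntegrable_const (c := ρ₂)).mono_fun' hρ.aestronglyMeasurable
      (Eventually.of_forall fun s => by
        simpa [abs_of_nonneg (hρ₁.le.trans (h₁ s))] using h₂ s)
  set θ : ℝ → ℝ := fun s => σ + ∫ τ in a..s, ρ τ with hθ
  have hdiff : ∀ p q, θ q - θ p = ∫ τ in p..q, ρ τ := fun p q => by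
    simp only [hθ, add_sub_add_left_eq_sub]
    exact intervalIntegral.integral_interval_sub_left (hint _ _) (hint _ _)
  have hgrow : ∀ p q, p ≤ q → ρ₁ * (q - p) ≤ θ q - θ p := fun p q hpq => by
    rw [hdiff]
    have := intervalIntegral.integral_mono_on hpq (intervalIntegrable_const (c := ρ₁)) (hint p q)
      fun s _ => h₁ s
    simpa [mul_comm] using this
  have hmono : StrictMono θ := fun p q hpq => by
    have := hgrow p q hpq.le
    have := mul_pos hρ₁ (sub_pos.2 hpq)
    linarith
  have hcont : Continuous θ :=
    continuous_const.add (intervalIntegral.continuous_primitive hint a)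
  have hsurj : Function.Surjective θ := by
    refine hcont.surjective ?_ ?_
    · refine tendsto_atTop_mono' _ (f₁ := fun s => θ 0 + ρ₁ * s) ?_
        (tendsto_atTop_add_const_left _ _ (tendsto_id.const_mul_atTop hρ₁))
      filter_upwards [eventually_ge_atTop 0] with s hs
      have := hgrow 0 s hs
      simp only [sub_zero] at this
      linarith
    · refine tendsto_atBot_mono' _ (f₁ := fun s => θ 0 + ρ₁ * s) ?_
        (tendsto_atBot_add_const_left _ _ (tendsto_id.const_mul_atBot hρ₁))
      filter_upwards [eventually_le_atBot 0] with s hs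
      have := hgrow s 0 hs
      simp only [zero_sub] at this
      linarith
  set e := StrictMono.orderIsoOfSurjective θ hmono hsurj with he
  have hee : ∀ s, e s = θ s := fun s => rfl
  have hpre : ∀ p q, e.symm ⁻¹' (Ioc p q) = Ioc (e p) (e q) := fun p q => by
    ext τ
    simp only [mem_preimage, mem_Ioc, e.lt_symm_apply, e.symm_apply_le]
  have hemb : MeasurableEmbedding e.symm := e.symm.toHomeomorph.measurableEmbedding
  have hν : ∀ p q, p < q → (volume.withDensity fun s => ((ρ s).toNNReal : ℝ≥0∞)) (Ioc p q) =
      ENNReal.ofReal (θ q - θ p) := fun p q hpq => by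
    rw [withDensity_apply _ measurableSet_Ioc, hdiff, intervalIntegral.integral_of_le hpq.le,
      ofReal_integral_eq_lintegral_ofReal (hint p q).1
        (Eventually.of_forall fun s => hρ₁.le.trans (h₁ s))]
    rfl
  have hmp : MeasurePreserving e.symm volume
      (volume.withDensity fun s => ((ρ s).toNNReal : ℝ≥0∞)) := by
    refine ⟨hemb.measurable, (Measure.ext_of_Ioc' _ _ (fun p q hpq => ?_) fun p q hpq => ?_).symm⟩
    · rw [hν p q hpq]; exact ENNReal.ofReal_ne_top
    · rw [hν p q hpq, hemb.map_apply, hpre, Real.volume_Ioc, hee, hee]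
  refine ⟨e, fun s => rfl, fun F p q hpq => ?_⟩
  rw [intervalIntegral.integral_of_le (e.monotone hpq), intervalIntegral.integral_of_le hpq,
    ← hpre, hmp.setIntegral_preimage_emb hemb,
    setIntegral_withDensity_eq_setIntegral_smul hρ.real_toNNReal _ measurableSet_Ioc]
  refine setIntegral_congr_fun measurableSet_Ioc fun s _ => ?_
  simp [NNReal.smul_def, hρ₁.le.trans (h₁ s)]

lemma LipschitzWith.intervalIntegrable_deriv_euc {n : ℕ} {K : NNReal} {y : ℝ → Euc n}
    (hy : LipschitzWith K y) (a b : ℝ) : IntervalIntegrable (deriv y) volume a b :=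
  (intervalIntegrable_const (c := (K : ℝ))).mono_fun' (measurable_deriv y).aestronglyMeasurable
    (Eventually.of_forall fun _ => norm_deriv_le_of_lipschitz hy)

lemma LipschitzWith.integral_deriv_euc {n : ℕ} {K : NNReal} {y : ℝ → Euc n}
    (hy : LipschitzWith K y) (a b : ℝ) : ∫ s in a..b, deriv y s = y b - y a := by
  ext i
  set P : Euc n →L[ℝ] ℝ := EuclideanSpace.proj i with hP
  have hi : LipschitzWith (‖P‖₊ * K) (P ∘ y) := P.lipschitz.comp hy
  have h := (hi.lipschitzOnWith (s := uIcc a b)).absolutelyContinuousOnInterval.integral_deriv_eq_sub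
  have h2 := P.intervalIntegral_comp_comm (hy.intervalIntegrable_deriv_euc a b)
  change P (∫ s in a..b, deriv y s) = P (y b) - P (y a)
  rw [← h2, ← Function.comp_apply (f := P) (x := b), ← Function.comp_apply (f := P) (x := a), ← h]
  refine intervalIntegral.integral_congr_ae ?_
  filter_upwards [hy.ae_differentiableAt_real] with s hs _
  exact (P.hasFDerivAt.comp_hasDerivAt s hs.hasDerivAt).deriv.symm

end TimeChange

section Arcs

variable {n : ℕ} {L : Euc n → Euc n → ℝ}

/-- There is an absolutely continuous arc on `[a, b]` from `x₀` to `x₁` of cost at most `C`. -/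
def HasArc (L : Euc n → Euc n → ℝ) (a b : ℝ) (x₀ x₁ : Euc n) (C : ℝ) : Prop :=
  ∃ z z' : ℝ → Euc n, IntervalIntegrable z' volume a b ∧
    (∀ s ∈ Icc a b, z s = x₀ + ∫ τ in a..s, z' τ) ∧ z b = x₁ ∧
    IntervalIntegrable (fun s => L (z s) (z' s)) volume a b ∧ ∫ s in a..b, L (z s) (z' s) ≤ C

lemma HasArc.arcInf_le {x u : Euc n} {h C : ℝ} (H : HasArc L (-h) 0 (x - h • u) x C) :
    arcInf L x u h ≤ ENNReal.ofReal C := by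
  obtain ⟨z, z', hz', hz, hz0, hint, hC⟩ := H
  refine le_trans ?_ (ENNReal.ofReal_le_ofReal hC)
  exact iInf_le_of_le z <| iInf_le_of_le z' <| iInf_le_of_le hz' <| iInf_le_of_le hz <|
    iInf_le_of_le hz0 <| iInf_le_of_le hint le_rfl

lemma HasArc.trans {a b c : ℝ} {x₀ x₁ x₂ : Euc n} {C D : ℝ} (hab : a ≤ b) (hbc : b ≤ c)
    (H : HasArc L a b x₀ x₁ C) (H' : HasArc L b c x₁ x₂ D) : HasArc L a c x₀ x₂ (C + D) := by
  obtain ⟨z, z', hz', hz, hzb, hint, hC⟩ := H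
  obtain ⟨w, w', hw', hw, hwc, hint', hD⟩ := H'
  have hwb : w b = x₁ := by simpa using hw b ⟨le_rfl, hbc⟩
  set v := fun s => if s ≤ b then z s else w s with hv
  set v' := fun s => if s ≤ b then z' s else w' s with hv'
  have hle : ∀ s ∈ uIoc a b, s ≤ b := fun s hs => by
    rw [uIoc_of_le hab] at hs; exact hs.2
  have hgt : ∀ s ∈ uIoc b c, ¬ s ≤ b := fun s hs => by
    rw [uIoc_of_le hbc] at hs; exact not_le.2 hs.1
  have e1 : EqOn z' v' (uIoc a b) := fun s hs => by simp [hv', hle s hs]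
  have e2 : EqOn w' v' (uIoc b c) := fun s hs => by simp [hv', hgt s hs]
  have f1 : EqOn (fun s => L (z s) (z' s)) (fun s => L (v s) (v' s)) (uIoc a b) :=
    fun s hs => by simp [hv, hv', hle s hs]
  have f2 : EqOn (fun s => L (w s) (w' s)) (fun s => L (v s) (v' s)) (uIoc b c) :=
    fun s hs => by simp [hv, hv', hgt s hs]
  have i1 := hz'.congr e1
  have i2 := hw'.congr e2
  have j1 := hint.congr f1
  have j2 := hint'.congr f2
  refine ⟨v, v', i1.trans i2, fun s hs => ?_, ?_, j1.trans j2, ?_⟩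
  · by_cases hsb : s ≤ b
    · have : ∫ τ in a..s, v' τ = ∫ τ in a..s, z' τ := by
        refine intervalIntegral.integral_congr_uIoo fun τ hτ => ?_
        rw [uIoo_of_le hs.1] at hτ
        simp [hv', hτ.2.le.trans hsb]
      rw [this, ← hz s ⟨hs.1, hsb⟩]
      simp [hv, hsb]
    · push Not at hsb
      have h2 : ∫ τ in b..s, v' τ = ∫ τ in b..s, w' τ := by
        refine intervalIntegral.integral_congr_uIoo fun τ hτ => ?_
        rw [uIoo_of_le hsb.le] at hτ
        simp [hv', not_le.2 hτ.1]
      have h1 : ∫ τ in a..b, v' τ = ∫ τ in a..b, z' τ :=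
        (intervalIntegral.integral_congr_uIoo fun τ hτ =>
          e1 (Ioo_subset_Ioc_self hτ)).symm
      have i3 : IntervalIntegrable v' volume b s :=
        i2.mono_set (by
          rw [uIcc_of_le hsb.le, uIcc_of_le hbc]; exact Icc_subset_Icc_right hs.2)
      rw [← intervalIntegral.integral_add_adjacent_intervals i1 i3, h1, h2, ← add_assoc,
        ← hz b ⟨hab, le_rfl⟩, hzb, ← hw s ⟨hsb.le, hs.2⟩]
      simp [hv, not_le.2 hsb]
  · rcases hbc.eq_or_lt with rfl | h
    · simp [hv, hzb, ← hwc, hwb]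
    · simp [hv, not_le.2 h, hwc]
  · rw [← intervalIntegral.integral_add_adjacent_intervals j1 j2]
    refine add_le_add (le_trans (le_of_eq ?_) hC) (le_trans (le_of_eq ?_) hD)
    · exact (intervalIntegral.integral_congr_uIoo fun τ hτ =>
          f1 (Ioo_subset_Ioc_self hτ)).symm
    · exact (intervalIntegral.integral_congr_uIoo fun τ hτ =>
          f2 (Ioo_subset_Ioc_self hτ)).symm

lemma intervalIntegrable_of_measurable_of_bound {f : ℝ → ℝ} (hf : Measurable f) {a b M : ℝ}
    (hab : a ≤ b) (h0 : ∀ s, 0 ≤ f s) (hM : ∀ s ∈ Icc a b, f s ≤ M) :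
    IntervalIntegrable f volume a b := by
  refine (intervalIntegrable_const (c := M)).mono_fun' hf.aestronglyMeasurable ?_
  refine (ae_restrict_iff' measurableSet_uIoc).2 (Eventually.of_forall fun s hs => ?_)
  rw [uIoc_of_le hab] at hs
  simpa [abs_of_nonneg (h0 s)] using hM s ⟨hs.1.le, hs.2⟩

lemma hasArc_segment (hL0 : ∀ x u, 0 ≤ L x u)
    (hLm : Measurable (fun p : Euc n × Euc n => L p.1 p.2)) {a b M : ℝ} (hab : a ≤ b)
    (x v : Euc n) (hM : ∀ s ∈ Icc a b, L (x + (s - a) • v) v ≤ M) :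
    HasArc L a b x (x + (b - a) • v) (M * (b - a)) := by
  have hm : Measurable (fun s : ℝ => L (x + (s - a) • v) v) :=
    hLm.comp (f := fun s : ℝ => (x + (s - a) • v, v))
      (Continuous.measurable (by fun_prop))
  have hint := intervalIntegrable_of_measurable_of_bound hm hab (fun s => hL0 _ _) hM
  refine ⟨fun s => x + (s - a) • v, fun _ => v, intervalIntegrable_const, fun s _ => by simp, rfl,
    hint, ?_⟩
  have := intervalIntegral.integral_mono_on hab hint (intervalIntegrable_const (c := M)) hM
  simpa [mul_comm] using this

/-- Running along a Lipschitz curve with the time scale changed by the density `ρ`. -/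
lemma hasArc_timeChange (hL0 : ∀ x u, 0 ≤ L x u)
    (hLm : Measurable (fun p : Euc n × Euc n => L p.1 p.2)) {K : NNReal} {y : ℝ → Euc n}
    (hy : LipschitzWith K y) {ρ : ℝ → ℝ} (hρ : Measurable ρ) {ρ₁ ρ₂ : ℝ}
    (hρ₁ : 0 < ρ₁) (h₁ : ∀ s, ρ₁ ≤ ρ s) (h₂ : ∀ s, ρ s ≤ ρ₂) (σ : ℝ) {a b M : ℝ} (hab : a ≤ b)
    (hM : ∀ s ∈ Icc a b, L (y s) ((ρ s)⁻¹ • deriv y s) ≤ M) :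
    HasArc L σ (σ + ∫ τ in a..b, ρ τ) (y a) (y b)
      (∫ s in a..b, ρ s * L (y s) ((ρ s)⁻¹ • deriv y s)) := by
  obtain ⟨e, he, hcov⟩ := exists_orderIso_integral_comp_symm hρ hρ₁ h₁ h₂ σ a
  have hea : e a = σ := by simp [he]
  have hm : Measurable e.symm := e.symm.toHomeomorph.measurable
  have hd : Measurable (fun s => (ρ s)⁻¹ • deriv y s) := hρ.inv.smul (measurable_deriv y)
  have hle : e a ≤ e b := e.monotone hab
  have hpos : ∀ s, 0 < ρ s := fun s => hρ₁.trans_le (h₁ s)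
  have hz' : ∀ p q, IntervalIntegrable
      (fun τ => (ρ (e.symm τ))⁻¹ • deriv y (e.symm τ)) volume p q := fun p q => by
    refine (intervalIntegrable_const (c := ρ₁⁻¹ * K)).mono_fun'
      (hd.comp hm).aestronglyMeasurable (Eventually.of_forall fun τ => ?_)
    simp only [norm_smul, norm_inv, Real.norm_of_nonneg (hpos _).le]
    have := h₁ (e.symm τ)
    gcongr
    exact norm_deriv_le_of_lipschitz hy
  rw [← he b, ← hea]
  refine ⟨fun τ => y (e.symm τ), fun τ => (ρ (e.symm τ))⁻¹ • deriv y (e.symm τ), hz' _ _, ?_,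
    by simp, ?_, ?_⟩
  · intro τ hτ
    have has : a ≤ e.symm τ := e.le_symm_apply.2 hτ.1
    have := hcov (fun s => (ρ s)⁻¹ • deriv y s) a (e.symm τ) has
    rw [e.apply_symm_apply] at this
    rw [this]
    have h : ∀ s, ρ s • (ρ s)⁻¹ • deriv y s = deriv y s := fun s =>
      smul_inv_smul₀ (hpos s).ne' _
    simp only [h, hy.integral_deriv_euc]
    abel
  · refine intervalIntegrable_of_measurable_of_bound (M := M) ?_ hle (fun _ => hL0 _ _) ?_
    · exact hLm.comp ((hy.continuous.measurable.comp hm).prodMk (hd.comp hm))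
    · intro τ hτ
      exact hM _ ⟨e.le_symm_apply.2 hτ.1, e.symm_apply_le.2 hτ.2⟩
  · have := hcov (fun s => L (y s) ((ρ s)⁻¹ • deriv y s)) a b hab
    exact this.le

end Arcs

section UpperBound

variable {n : ℕ} {L : Euc n → Euc n → ℝ}

/-- The points `x` such that `L x` is bounded by `k` on the closed ball of radius `R`. -/
def boundedSpeedSet (L : Euc n → Euc n → ℝ) (R k : ℝ) : Set (Euc n) :=
  {x | ∀ v, ‖v‖ ≤ R → L x v ≤ k}

lemma isClosed_boundedSpeedSet
    (hLlsc : LowerSemicontinuous (fun p : Euc n × Euc n => L p.1 p.2)) (R k : ℝ) :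
    IsClosed (boundedSpeedSet L R k) := by
  have : boundedSpeedSet L R k = ⋂ (v : Euc n) (_ : ‖v‖ ≤ R), {x | L x v ≤ k} := by
    ext x; simp [boundedSpeedSet]
  rw [this]
  refine isClosed_iInter fun v => isClosed_iInter fun _ => ?_
  exact (hLlsc.isClosed_preimage k).preimage (f := fun x : Euc n => (x, v)) (by fun_prop)

lemma continuous_of_convexOn_univ (hLconv : ∀ x, ConvexOn ℝ Set.univ (L x)) (x : Euc n) :
    Continuous (L x) :=
  continuousOn_univ.1 ((hLconv x).continuousOn isOpen_univ)

lemma exists_mem_boundedSpeedSet (hLconv : ∀ x, ConvexOn ℝ Set.univ (L x)) (R : ℝ) (x : Euc n) :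
    ∃ k : ℕ, x ∈ boundedSpeedSet L R k := by
  obtain ⟨k, hk⟩ := (isCompact_closedBall (0 : Euc n) R).bddAbove_image
    (continuous_of_convexOn_univ hLconv x).continuousOn
  obtain ⟨m, hm⟩ := exists_nat_ge k
  exact ⟨m, fun v hv => (hk ⟨v, by simpa using hv, rfl⟩).trans hm⟩

lemma HasDerivAt.eventually_norm_sub_left_le {F : Type*} [NormedAddCommGroup F] [NormedSpace ℝ F]
    {f : ℝ → F} {f' : F} {t : ℝ} (hf : HasDerivAt f f' t) {ε : ℝ} (hε : 0 < ε) :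
    ∀ᶠ h in 𝓝[>] (0 : ℝ), ‖f t - f (t - h) - h • f'‖ ≤ ε * h := by
  have h1 := (hasDerivAt_iff_isLittleO.1 hf).bound hε
  have h2 : Tendsto (fun h : ℝ => t - h) (𝓝[>] 0) (𝓝 t) := by
    have : Tendsto (fun h : ℝ => t - h) (𝓝 0) (𝓝 (t - 0)) :=
      Continuous.tendsto (by fun_prop) 0
    rw [sub_zero] at this
    exact this.mono_left nhdsWithin_le_nhds
  filter_upwards [h2.eventually h1, self_mem_nhdsWithin] with h hh hpos
  replace hpos : 0 < h := hpos
  have e : t - h - t = -h := by ring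
  rw [e, norm_neg, Real.norm_of_nonneg hpos.le, neg_smul, sub_neg_eq_add] at hh
  rwa [← norm_neg, show -(f t - f (t - h) - h • f') = f (t - h) - f t + h • f' by abel]

/-- The length of the time spent outside a set of times, as an integrand. -/
noncomputable def outside (G : Set ℝ) : ℝ → ℝ := Gᶜ.indicator fun _ => 1

lemma outside_nonneg (G : Set ℝ) (s : ℝ) : 0 ≤ outside G s :=
  indicator_nonneg (fun _ _ => zero_le_one) s

lemma outside_le_one (G : Set ℝ) (s : ℝ) : outside G s ≤ 1 :=
  indicator_le_self' (fun _ _ => zero_le_one) s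

lemma measurable_outside {G : Set ℝ} (hG : MeasurableSet G) : Measurable (outside G) :=
  measurable_const.indicator hG.compl

lemma intervalIntegrable_outside {G : Set ℝ} (hG : MeasurableSet G) (a b : ℝ) :
    IntervalIntegrable (outside G) volume a b :=
  (intervalIntegrable_const (c := (1 : ℝ))).mono_fun' (measurable_outside hG).aestronglyMeasurable
    (Eventually.of_forall fun s => by
      simpa [abs_of_nonneg (outside_nonneg G s)] using outside_le_one G s)

/-- The running cost, at speed multiplied by `c`, restricted to a set of times. -/
noncomputable def scaledCost (L : Euc n → Euc n → ℝ) (y : ℝ → Euc n) (c : ℝ) (G : Set ℝ) :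
    ℝ → ℝ :=
  G.indicator fun s => L (y s) (c • deriv y s)

lemma scaledCost_nonneg (hL0 : ∀ x u, 0 ≤ L x u) (y : ℝ → Euc n) (c : ℝ) (G : Set ℝ) (s : ℝ) :
    0 ≤ scaledCost L y c G s :=
  indicator_nonneg (fun _ _ => hL0 _ _) s

lemma measurable_scaledCost (hLm : Measurable (fun p : Euc n × Euc n => L p.1 p.2))
    {y : ℝ → Euc n} (hy : Continuous y) (c : ℝ) {G : Set ℝ} (hG : MeasurableSet G) :
    Measurable (scaledCost L y c G) :=
  (hLm.comp (hy.measurable.prodMk ((measurable_deriv y).const_smul c))).indicator hG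

lemma scaledCost_le {K : NNReal} {y : ℝ → Euc n} (hy : LipschitzWith K y) {c k : ℝ}
    (hc0 : 0 ≤ c) (hc : c ≤ 2) (hk : 0 ≤ k) (s : ℝ) :
    scaledCost L y c (y ⁻¹' boundedSpeedSet L (2 * K) k) s ≤ k := by
  refine indicator_apply_le' (fun hs => hs _ ?_) fun _ => hk
  rw [norm_smul, Real.norm_of_nonneg hc0]
  gcongr
  exact norm_deriv_le_of_lipschitz hy

lemma locallyIntegrable_of_measurable_of_bound {f : ℝ → ℝ} (hf : Measurable f) {k : ℝ}
    (h0 : ∀ s, 0 ≤ f s) (hk : ∀ s, f s ≤ k) : LocallyIntegrable f volume :=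
  (locallyIntegrable_const k).mono hf.aestronglyMeasurable (Eventually.of_forall fun s => by
    rw [Real.norm_of_nonneg (h0 s), Real.norm_of_nonneg ((h0 s).trans (hk s))]; exact hk s)

/-- At a density point of the times when `L` is controlled at speeds up to `2 * K`, following the
curve slightly faster there, slowly elsewhere, and resting gives a good competitor. -/
lemma LPlus_le_of_hasDerivAt (hL0 : ∀ x u, 0 ≤ L x u)
    (hLlsc : LowerSemicontinuous (fun p : Euc n × Euc n => L p.1 p.2))
    {K : NNReal} {y : ℝ → Euc n} (hy : LipschitzWith K y) {c k t M r : ℝ} {u : Euc n}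
    {G : Set ℝ} (hG : G = y ⁻¹' boundedSpeedSet L (2 * K) k)
    (hc1 : 1 < c) (hc2 : c ≤ 2) (hr : 0 < r) (hk : 0 ≤ k)
    (hM : ∀ x v, ‖x - y t‖ ≤ r → ‖v‖ ≤ r → L x v ≤ M)
    (hyt : HasDerivAt y u t)
    (hout : HasDerivAt (fun x => ∫ s in (0 : ℝ)..x, outside G s) 0 t)
    (hcost : HasDerivAt (fun x => ∫ s in (0 : ℝ)..x, scaledCost L y c G s)
      (scaledCost L y c G t) t) :
    LPlus L (y t) u ≤ ENNReal.ofReal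
      (c⁻¹ * scaledCost L y c G t + (1 - c⁻¹) / 2 * (1 + 3 * M)) := by
  have hLm : Measurable (fun p : Euc n × Euc n => L p.1 p.2) := hLlsc.measurable
  have hGm : MeasurableSet G := by
    rw [hG]
    exact ((isClosed_boundedSpeedSet hLlsc _ _).preimage hy.continuous).measurableSet
  have hc0 : 0 < c := by linarith
  have hcinv : c⁻¹ < 1 := inv_lt_one_of_one_lt₀ hc1
  have hcinv0 : 0 < c⁻¹ := inv_pos.2 hc0
  have hM0 : 0 ≤ M := (hL0 (y t) 0).trans (hM _ _ (by simpa using hr.le) (by simpa using hr.le))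
  set η := (1 - c⁻¹) / 2 with hη
  have hη0 : 0 < η := by rw [hη]; linarith
  set d := max 1 (K / r) with hd
  have hd1 : 1 ≤ d := le_max_left _ _
  have hd0 : 0 < d := by linarith
  have hKd : d⁻¹ * K ≤ r := by
    have h : (K : ℝ) / r ≤ d := le_max_right _ _
    rw [div_le_iff₀ hr] at h
    rw [inv_mul_le_iff₀ hd0]
    exact h
  set f := scaledCost L y c G with hf
  have hf0 : ∀ s, 0 ≤ f s := scaledCost_nonneg hL0 y c G
  have hfk : ∀ s, f s ≤ k := fun s => by
    rw [hf, hG]; exact scaledCost_le hy hc0.le hc2 hk s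
  have hfm : Measurable f := measurable_scaledCost hLm hy.continuous c hGm
  have hfint : ∀ a b, IntervalIntegrable f volume a b := fun a b =>
    intervalIntegrable_iff.2 (((locallyIntegrable_of_measurable_of_bound hfm hf0
      hfk).integrableOn_isCompact isCompact_uIcc).mono_set uIoc_subset_uIcc)
  have hoint : ∀ a b, IntervalIntegrable (outside G) volume a b := intervalIntegrable_outside hGm
  have huK : ‖u‖ ≤ K := hyt.deriv ▸ norm_deriv_le_of_lipschitz hy
  set ρ : ℝ → ℝ := fun s => c⁻¹ + (d - c⁻¹) * outside G s with hρ
  have hρm : Measurable ρ := ((measurable_outside hGm).const_mul _).const_add _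
  have hdc : 0 ≤ d - c⁻¹ := by linarith
  have hρ₁ : ∀ s, c⁻¹ ≤ ρ s := fun s => by
    have := mul_nonneg hdc (outside_nonneg G s)
    simp only [hρ]; linarith
  have hρ₂ : ∀ s, ρ s ≤ d := fun s => by
    have := mul_le_mul_of_nonneg_left (outside_le_one G s) hdc
    simp only [hρ]; linarith
  have hρin : ∀ s ∈ G, ρ s = c⁻¹ := fun s hs => by simp [hρ, outside, hs]
  have hρout : ∀ s, s ∉ G → ρ s = d := fun s hs => by simp [hρ, outside, hs]
  have hsmall : ∀ᶠ h in 𝓝[>] (0 : ℝ), K * h < r := by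
    have : Tendsto (fun h : ℝ => K * h) (𝓝 0) (𝓝 (K * 0)) := Continuous.tendsto (by fun_prop) 0
    rw [mul_zero] at this
    exact (this.mono_left nhdsWithin_le_nhds).eventually_lt_const hr
  refine limsup_le_of_le (by isBoundedDefault) ?_
  filter_upwards [self_mem_nhdsWithin, hsmall, hyt.eventually_norm_sub_left_le (mul_pos hr hη0),
    hout.eventually_norm_sub_left_le (div_pos hη0 hd0),
    hcost.eventually_norm_sub_left_le hη0] with h hpos hKh e1 e2 e3
  replace hpos : 0 < h := hpos
  rw [intervalIntegral.integral_interval_sub_left (hoint _ _) (hoint _ _), smul_zero, sub_zero]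
    at e2
  rw [intervalIntegral.integral_interval_sub_left (hfint _ _) (hfint _ _), smul_eq_mul] at e3
  replace e2 := (le_abs_self _).trans e2
  replace e3 := (le_abs_self _).trans e3
  have hth : t - h ≤ t := by linarith
  have hnear : ∀ s ∈ Icc (t - h) t, ‖y s - y t‖ ≤ r := fun s hs => by
    have h1 := hy.norm_sub_le s t
    have h2 : ‖s - t‖ ≤ h := by rw [Real.norm_eq_abs, abs_le]; constructor <;> linarith [hs.1, hs.2]
    have h3 : (K : ℝ) * ‖s - t‖ ≤ K * h := by gcongr
    linarith
  have hGk : ∀ s ∈ G, L (y s) (c • deriv y s) = f s := fun s hs => by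
    simp [hf, scaledCost, hs]
  have hBM : ∀ s ∈ Icc (t - h) t, L (y s) (d⁻¹ • deriv y s) ≤ M := fun s hs => by
    refine hM _ _ (hnear s hs) ?_
    rw [norm_smul, Real.norm_of_nonneg (inv_pos.2 hd0).le]
    refine le_trans ?_ hKd
    gcongr
    exact norm_deriv_le_of_lipschitz hy
  have hLbdd : ∀ s ∈ Icc (t - h) t, L (y s) ((ρ s)⁻¹ • deriv y s) ≤ max k M := fun s hs => by
    by_cases hsG : s ∈ G
    · rw [hρin s hsG, inv_inv, hGk s hsG]; exact (hfk s).trans (le_max_left _ _)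
    · rw [hρout s hsG]; exact (hBM s hs).trans (le_max_right _ _)
  -- approach of the curve
  have harc1 : HasArc L (-h) (-h + η * h) (y t - h • u) (y (t - h)) (M * (η * h)) := by
    have hηh : 0 < η * h := mul_pos hη0 hpos
    set w := y t - h • u with hw
    set v := (η * h)⁻¹ • (y (t - h) - w) with hv
    have hvr : ‖v‖ ≤ r := by
      rw [hv, norm_smul, Real.norm_of_nonneg (inv_pos.2 hηh).le, inv_mul_le_iff₀ hηh, ← norm_neg,
        show -(y (t - h) - w) = y t - y (t - h) - h • u by rw [hw]; abel]
      exact e1.trans_eq (by ring)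
    have hend : w + (-h + η * h - -h) • v = y (t - h) := by
      rw [hv, show -h + η * h - -h = η * h by ring, smul_inv_smul₀ hηh.ne']; abel
    have hpt : ∀ s ∈ Icc (-h) (-h + η * h), L (w + (s - -h) • v) v ≤ M := fun s hs => by
      refine hM _ _ ?_ hvr
      have hwr : w ∈ Metric.closedBall (y t) r := by
        rw [mem_closedBall_iff_norm, hw, sub_sub_cancel_left, norm_neg, norm_smul,
          Real.norm_of_nonneg hpos.le]
        have : h * ‖u‖ ≤ h * K := by gcongr
        linarith
      have hyr : y (t - h) ∈ Metric.closedBall (y t) r := by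
        rw [mem_closedBall_iff_norm]
        exact hnear _ ⟨le_rfl, hth⟩
      have := (convex_closedBall (y t) r).add_smul_sub_mem hwr hyr
        (t := (s - -h) * (η * h)⁻¹) ⟨mul_nonneg (by linarith [hs.1]) (inv_pos.2 hηh).le, by
          rw [mul_inv_le_iff₀ hηh]; linarith [hs.2]⟩
      rw [mul_smul] at this
      rwa [mem_closedBall_iff_norm] at this
    have := hasArc_segment hL0 hLm (by linarith : -h ≤ -h + η * h) w v hpt
    rw [hend] at this
    rwa [show -h + η * h - -h = η * h by ring] at this
  -- the curve itself
  have harc2 := hasArc_timeChange hL0 hLm hy hρm hcinv0 hρ₁ hρ₂ (-h + η * h) hth hLbdd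
  have htime : ∫ τ in (t - h)..t, ρ τ = h * c⁻¹ + (d - c⁻¹) * ∫ τ in (t - h)..t, outside G τ := by
    simp only [hρ]
    rw [intervalIntegral.integral_add (by simp) ((hoint _ _).const_mul _),
      intervalIntegral.integral_const_mul]
    simp
  have ho0 : 0 ≤ ∫ τ in (t - h)..t, outside G τ :=
    intervalIntegral.integral_nonneg hth fun s _ => outside_nonneg G s
  have hdo : d * ∫ τ in (t - h)..t, outside G τ ≤ η * h := by
    have := mul_le_mul_of_nonneg_left e2 hd0.le
    rwa [← mul_assoc, mul_div_cancel₀ _ hd0.ne'] at this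
  have hcosts : ∫ s in (t - h)..t, ρ s * L (y s) ((ρ s)⁻¹ • deriv y s) ≤
      c⁻¹ * (h * f t + η * h) + M * (η * h) := by
    have hm : Measurable fun s => ρ s * L (y s) ((ρ s)⁻¹ • deriv y s) :=
      hρm.mul (hLm.comp (hy.continuous.measurable.prodMk (hρm.inv.smul (measurable_deriv y))))
    have hi : IntervalIntegrable (fun s => ρ s * L (y s) ((ρ s)⁻¹ • deriv y s)) volume
        (t - h) t := by
      refine intervalIntegrable_of_measurable_of_bound (M := d * max k M) hm hth
        (fun s => mul_nonneg (hcinv0.le.trans (hρ₁ s)) (hL0 _ _)) fun s hs => ?_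
      exact mul_le_mul (hρ₂ s) (hLbdd s hs) (hL0 _ _) hd0.le
    have hle : ∫ s in (t - h)..t, ρ s * L (y s) ((ρ s)⁻¹ • deriv y s) ≤
        ∫ s in (t - h)..t, (c⁻¹ * f s + M * (d * outside G s)) := by
      refine intervalIntegral.integral_mono_on hth hi
        (((hfint _ _).const_mul _).add (((hoint _ _).const_mul _).const_mul _)) fun s hs => ?_
      by_cases hsG : s ∈ G
      · rw [hρin s hsG, inv_inv, hGk s hsG]
        simp [outside, hsG]
      · rw [hρout s hsG]
        have := mul_le_mul_of_nonneg_left (hBM s hs) hd0.le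
        simp only [hf, scaledCost, outside, hsG, not_false_eq_true, indicator_of_notMem, mul_zero,
          zero_add, mem_compl_iff, indicator_of_mem, mul_one]
        linarith
    rw [intervalIntegral.integral_add ((hfint _ _).const_mul _)
      (((hoint _ _).const_mul _).const_mul _), intervalIntegral.integral_const_mul,
      intervalIntegral.integral_const_mul, intervalIntegral.integral_const_mul] at hle
    refine hle.trans (add_le_add ?_ ?_)
    · gcongr; linarith
    · gcongr
  -- rest
  set σ := -h + η * h + ∫ τ in (t - h)..t, ρ τ with hσ
  have h2η : h * c⁻¹ = h - 2 * (η * h) := by rw [hη]; ring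
  have hσ0 : σ ≤ 0 := by
    have := mul_nonneg hcinv0.le ho0
    rw [hσ, htime]; linarith
  have hσ1 : 0 - σ ≤ η * h := by
    have := mul_nonneg hdc ho0
    rw [hσ, htime]; linarith
  have harc3 := hasArc_segment hL0 hLm hσ0 (y t) 0 (M := M) fun s _ =>
    hM _ _ (by simpa using hr.le) (by simpa using hr.le)
  rw [smul_zero, add_zero] at harc3
  have harc12 := harc1.trans (by linarith [mul_pos hη0 hpos])
    (by
      have := mul_nonneg hdc ho0
      rw [hσ, htime]; linarith [mul_pos hpos hcinv0]) harc2
  have harc := harc12.trans (by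
      have := mul_nonneg hdc ho0
      rw [hσ, htime]; linarith [mul_pos hpos hcinv0, mul_pos hη0 hpos]) hσ0 harc3
  rw [ENNReal.div_le_iff (by simp [hpos]) (by simp), mul_comm, ← ENNReal.ofReal_mul hpos.le]
  refine harc.arcInf_le.trans (ENNReal.ofReal_le_ofReal ?_)
  have h3 := mul_le_mul_of_nonneg_left hσ1 hM0
  have h4 : c⁻¹ * (η * h) ≤ η * h := by
    have := mul_le_mul_of_nonneg_right hcinv.le (mul_pos hη0 hpos).le
    linarith
  linarith

/-- Almost everywhere along a Lipschitz curve, the relaxed Lagrangian is at most `L`. -/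
lemma LipschitzWith.ae_LPlus_le (hL0 : ∀ x u, 0 ≤ L x u)
    (hLlsc : LowerSemicontinuous (fun p : Euc n × Euc n => L p.1 p.2))
    (hLconv : ∀ x, ConvexOn ℝ Set.univ (L x)) (hLbd : LocallyBounded L)
    {K : NNReal} {y : ℝ → Euc n} (hy : LipschitzWith K y) :
    ∀ᵐ t, LPlus L (y t) (deriv y t) ≤ ENNReal.ofReal (L (y t) (deriv y t)) := by
  set c : ℕ → ℝ := fun m => 1 + 1 / ((m : ℝ) + 1) with hc
  have hc1 : ∀ m, 1 < c m := fun m => by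
    have : (0 : ℝ) < 1 / ((m : ℝ) + 1) := by positivity
    simp only [hc]; linarith
  have hc2 : ∀ m, c m ≤ 2 := fun m => by
    have : 1 / ((m : ℝ) + 1) ≤ 1 := by
      rw [div_le_one (by positivity)]; linarith [Nat.cast_nonneg (α := ℝ) m]
    simp only [hc]; linarith
  have hclim : Tendsto c atTop (𝓝 1) := by
    simpa [hc] using tendsto_one_div_add_atTop_nhds_zero_nat.const_add (1 : ℝ)
  set G : ℕ → Set ℝ := fun k => y ⁻¹' boundedSpeedSet L (2 * K) k with hG
  have hGm : ∀ k, MeasurableSet (G k) := fun k =>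
    ((isClosed_boundedSpeedSet hLlsc _ _).preimage hy.continuous).measurableSet
  have hout : ∀ k, ∀ᵐ t, ∀ a, HasDerivAt (fun x => ∫ s in a..x, outside (G k) s)
      (outside (G k) t) t := fun k =>
    LocallyIntegrable.ae_hasDerivAt_integral <| locallyIntegrable_of_measurable_of_bound
      (measurable_outside (hGm k)) (outside_nonneg _) (outside_le_one _)
  have hcost : ∀ k m, ∀ᵐ t, ∀ a, HasDerivAt (fun x => ∫ s in a..x, scaledCost L y (c m) (G k) s)
      (scaledCost L y (c m) (G k) t) t := fun k m =>
    LocallyIntegrable.ae_hasDerivAt_integral <| locallyIntegrable_of_measurable_of_bound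
      (measurable_scaledCost hLlsc.measurable hy.continuous _ (hGm k)) (scaledCost_nonneg hL0 _ _ _)
      (scaledCost_le hy (zero_le_one.trans (hc1 m).le) (hc2 m)
        (Nat.cast_nonneg k))
  filter_upwards [hy.ae_differentiableAt_real, ae_all_iff.2 hout,
    ae_all_iff.2 fun k => ae_all_iff.2 (hcost k)] with t hyt hout hcost
  obtain ⟨k, hk⟩ := exists_mem_boundedSpeedSet hLconv (2 * K) (y t)
  obtain ⟨M, r, hr, hM⟩ := hLbd (y t)
  have htG : t ∈ G k := hk
  have hbound : ∀ m, LPlus L (y t) (deriv y t) ≤ ENNReal.ofReal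
      ((c m)⁻¹ * L (y t) (c m • deriv y t) + (1 - (c m)⁻¹) / 2 * (1 + 3 * M)) := fun m => by
    have hout0 := hout k 0
    have h0 : outside (G k) t = 0 := by simp [outside, htG]
    have h1 : scaledCost L y (c m) (G k) t = L (y t) (c m • deriv y t) := by
      simp [scaledCost, htG]
    rw [h0] at hout0
    rw [← h1]
    exact LPlus_le_of_hasDerivAt hL0 hLlsc hy (hG ▸ rfl) (hc1 m) (hc2 m) hr (Nat.cast_nonneg k) hM
      hyt.hasDerivAt hout0 (hcost k m 0)
  refine ge_of_tendsto' (x := atTop) ?_ hbound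
  refine ENNReal.tendsto_ofReal ?_
  have hinv : Tendsto (fun m => (c m)⁻¹) atTop (𝓝 1) := by simpa using hclim.inv₀ one_ne_zero
  have hL : Tendsto (fun m => L (y t) (c m • deriv y t)) atTop (𝓝 (L (y t) (deriv y t))) := by
    have := ((continuous_of_convexOn_univ hLconv (y t)).tendsto _).comp
      (hclim.smul_const (deriv y t))
    rwa [one_smul] at this
  simpa using (hinv.mul hL).add (((hinv.const_sub 1).div_const 2).mul_const (1 + 3 * M))

end UpperBound

theorem stmt_15 {n : ℕ}
    (L : EuclideanSpace ℝ (Fin n) → EuclideanSpace ℝ (Fin n) → ℝ)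
    (hL0 : ∀ x u, 0 ≤ L x u)
    (hLlsc : LowerSemicontinuous
      (fun p : EuclideanSpace ℝ (Fin n) × EuclideanSpace ℝ (Fin n) => L p.1 p.2))
    (hLconv : ∀ x, ConvexOn ℝ Set.univ (L x))
    (Θ : EuclideanSpace ℝ (Fin n) → ℝ) (hΘ0 : ∀ u, 0 ≤ Θ u)
    (hΘconv : ConvexOn ℝ Set.univ Θ) (hΘsuper : Superlinear Θ)
    (hcoerc : ∀ x u, Θ u ≤ L x u)
    (hLbd : LocallyBounded L)
    (T : ℝ) (hT : 0 < T) (K : NNReal)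
    (y : ℝ → EuclideanSpace ℝ (Fin n)) (hy : LipschitzOnWith K y (Set.Icc 0 T))
    (y' : ℝ → EuclideanSpace ℝ (Fin n))
    (hy' : ∀ᵐ t ∂(volume.restrict (Set.Icc (0:ℝ) T)), HasDerivAt y (y' t) t) :
    ∀ᵐ t ∂(volume.restrict (Set.Icc (0:ℝ) T)),
      ENNReal.ofReal (L (y t) (y' t)) = LPlus L (y t) (y' t) := by

  have hproj : LipschitzWith K (fun t => y (projIcc 0 T hT.le t)) := by
    have := hy.to_restrict.comp (LipschitzWith.projIcc hT.le)
    rwa [mul_one] at this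
  set z : ℝ → EuclideanSpace ℝ (Fin n) := fun t => y (projIcc 0 T hT.le t) with hz
  have hzy : ∀ t ∈ Icc 0 T, z t = y t := fun t ht => by simp [hz, projIcc_of_mem hT.le ht]
  have hupper := ae_restrict_of_ae (s := Ioo 0 T) (hproj.ae_LPlus_le hL0 hLlsc hLconv hLbd)
  rw [← restrict_Ioo_eq_restrict_Icc] at hy' ⊢
  filter_upwards [hy', hupper, ae_restrict_mem measurableSet_Ioo] with t hyt hle ht
  have hev : z =ᶠ[𝓝 t] y := by
    filter_upwards [isOpen_Ioo.mem_nhds ht] with s hs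
    exact hzy s (Ioo_subset_Icc_self hs)
  rw [hev.deriv_eq, hyt.deriv, hev.eq_of_nhds] at hle
  exact le_antisymm (ofReal_le_LPlus hL0 hLlsc hLconv hΘsuper hcoerc _ _) hle
end
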